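/- Let A be an affine subspace of ℝ^n intersecting ∂B₁, x̄ ∈ A ∩ ∂B₁, s̄ = sign(D*x̄), J̄ = cosupp(D*x̄), F̄ = B₁ ∩ {x : ⟨Ds̄, x⟩ = 1}, and Ḡ = A ∩ F̄. Then: (i) Ḡ is the smallest face of A ∩ B₁ containing x̄ (every face G of A ∩ B₁ with x̄ ∈ G contains Ḡ), and Ḡ is the unique face G of A ∩ B₁ with x̄ ∈ ri(G); (ii) Ḡ = A ∩ ∂B₁ ∩ {x : sign(D*x) ≼ s̄}, ri(Ḡ) = A ∩ ∂B₁ ∩ {x : sign(D*x) = s̄}, and dir(Ḡ) = dir(A) ∩ (Ds̄)⊥ ∩ Ker D*_J̄; (iii) if moreover A ∩ B₁ ⊆ ∂B₁, then Ḡ = A ∩ {x : sign(D*x) ≼ s̄}, ri(Ḡ) = A ∩ {x : sign(D*x) = s̄}, and dir(Ḡ) = dir(A) ∩ Ker D*_J̄. -/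

import Mathlib

open Matrix Set

noncomputable section

/-- `Vec n` is `ℝ^n`. -/
abbrev Vec (n : ℕ) := Fin n → ℝ

/-- The ℓ¹-norm on `ℝ^p`. -/
def l1 {p : ℕ} (θ : Vec p) : ℝ := ∑ i, |θ i|

/-- The componentwise sign vector. -/
def sgn {p : ℕ} (θ : Vec p) : Vec p := fun i => Real.sign (θ i)

/-- `s` is a sign vector, i.e. `s ∈ {-1,0,1}^p`. -/
def IsSignVec {p : ℕ} (s : Vec p) : Prop := ∀ i, s i = -1 ∨ s i = 0 ∨ s i = 1

/-- The order `s ≼ s'` on sign vectors: `sᵢ ≠ 0 → s'ᵢ = sᵢ`. -/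
def sleq {p : ℕ} (s s' : Vec p) : Prop := ∀ i, s i ≠ 0 → s' i = s i

/-- The cosupport `{i : uᵢ = 0}`. -/
def cosupp {p : ℕ} (u : Vec p) : Set (Fin p) := {i | u i = 0}

/-- The analysis operator `D* x = Dᵀ x`. -/
def Dstar {n p : ℕ} (D : Matrix (Fin n) (Fin p) ℝ) (x : Vec n) : Vec p := Dᵀ *ᵥ x

/-- The ball `B_r = {x : ‖D*x‖₁ ≤ r}`. -/
def Ball {n p : ℕ} (D : Matrix (Fin n) (Fin p) ℝ) (r : ℝ) : Set (Vec n) :=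
  {x | l1 (Dstar D x) ≤ r}

/-- The sphere `∂B_r = {x : ‖D*x‖₁ = r}`. -/
def Sph {n p : ℕ} (D : Matrix (Fin n) (Fin p) ℝ) (r : ℝ) : Set (Vec n) :=
  {x | l1 (Dstar D x) = r}

/-- `Ker D*_J = {x : (D*x)ᵢ = 0 for all i ∈ J}`. -/
def kerDJ {n p : ℕ} (D : Matrix (Fin n) (Fin p) ℝ) (J : Set (Fin p)) : Set (Vec n) :=
  {x | ∀ i ∈ J, Dstar D x i = 0}

/-- The relative interior of a set. -/
def ri {n : ℕ} (C : Set (Vec n)) : Set (Vec n) := intrinsicInterior ℝ C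

/-- The direction of (the affine hull of) a set, as a set of vectors. -/
def dir {n : ℕ} (C : Set (Vec n)) : Set (Vec n) := ((affineSpan ℝ C).direction : Set (Vec n))

/-- `F` is an exposed face of `X`: the intersection of `X` with a supporting hyperplane. -/
def IsExposedFace {n : ℕ} (X F : Set (Vec n)) : Prop :=
  ∃ (α : Vec n) (β : ℝ), α ≠ 0 ∧ (∀ x ∈ X, α ⬝ᵥ x ≤ β) ∧ F = X ∩ {x | α ⬝ᵥ x = β}

/-- `G` is a face of `X`: a convex extreme subset of `X`. -/
def IsFace {n : ℕ} (X G : Set (Vec n)) : Prop := Convex ℝ G ∧ IsExtreme ℝ X G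

/-- `x` is an extreme point of `C`: it is not the midpoint of two distinct points of `C`. -/
def IsExtremePt {n : ℕ} (C : Set (Vec n)) (x : Vec n) : Prop :=
  x ∈ C ∧ ∀ x₁ ∈ C, ∀ x₂ ∈ C, x = midpoint ℝ x₁ x₂ → x₁ = x₂

/-- The objective `L(x) = (1/2)‖y − Φx‖₂² + λ‖D*x‖₁`. -/
def Lfun {n p q : ℕ} (D : Matrix (Fin n) (Fin p) ℝ) (Phi : Matrix (Fin q) (Fin n) ℝ)
    (y : Vec q) (lam : ℝ) (x : Vec n) : ℝ :=
  (1/2 : ℝ) * ((y - Phi *ᵥ x) ⬝ᵥ (y - Phi *ᵥ x)) + lam * l1 (Dstar D x)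

lemma aux_dot {n p : ℕ} (D : Matrix (Fin n) (Fin p) ℝ) (s : Vec p) (x : Vec n) :
    (D *ᵥ s) ⬝ᵥ x = ∑ i, s i * Dstar D x i := by
  have h : (D *ᵥ s) ⬝ᵥ x = s ⬝ᵥ (Dᵀ *ᵥ x) := by
    rw [Matrix.mulVec_transpose, dotProduct_comm, Matrix.dotProduct_mulVec, dotProduct_comm]
  rw [h]; rfl

lemma aux_Dadd {n p : ℕ} (D : Matrix (Fin n) (Fin p) ℝ) (x d : Vec n) (t : ℝ) (i : Fin p) :
    Dstar D (x + t • d) i = Dstar D x i + t * Dstar D d i := by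
  simp [Dstar, Matrix.mulVec_add, Matrix.mulVec_smul]

lemma aux_Dsub {n p : ℕ} (D : Matrix (Fin n) (Fin p) ℝ) (x d : Vec n) (i : Fin p) :
    Dstar D (x - d) i = Dstar D x i - Dstar D d i := by
  simp [Dstar, Matrix.mulVec_sub]

lemma aux_Dcont {n p : ℕ} (D : Matrix (Fin n) (Fin p) ℝ) (i : Fin p) :
    Continuous (fun x : Vec n => Dstar D x i) := by
  unfold Dstar
  fun_prop

/-- Extending segments past a relative interior point. -/
lemma aux_ri_extend {n : ℕ} {C : Set (Vec n)} {x y : Vec n} (hx : x ∈ ri C) (hy : y ∈ C) :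
    ∃ ε : ℝ, 0 < ε ∧ x + ε • (x - y) ∈ C := by
  unfold ri at hx
  rw [mem_intrinsicInterior] at hx
  obtain ⟨z, hz, rfl⟩ := hx
  rw [mem_interior_iff_mem_nhds, nhds_subtype, Filter.mem_comap] at hz
  obtain ⟨U, hU, hUC⟩ := hz
  have hc : Continuous (fun t : ℝ => (z : Vec n) + t • ((z : Vec n) - y)) := by fun_prop
  have h0 : ∀ᶠ t : ℝ in nhds 0, (z : Vec n) + t • ((z : Vec n) - y) ∈ U := by
    apply hc.continuousAt.eventually_mem
    simpa using hU
  rw [Metric.eventually_nhds_iff] at h0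
  obtain ⟨ε, hε, h⟩ := h0
  refine ⟨ε / 2, by positivity, ?_⟩
  have hm : (z : Vec n) + (ε / 2) • ((z : Vec n) - y) ∈ U := by
    apply h
    rw [Real.dist_eq, sub_zero, abs_of_pos (by positivity)]; linarith
  have hS : (z : Vec n) + (ε / 2) • ((z : Vec n) - y) ∈ affineSpan ℝ C := by
    have := AffineMap.lineMap_mem (-(ε / 2)) z.2 (subset_affineSpan ℝ C hy)
    rw [AffineMap.lineMap_apply] at this
    convert this using 1
    simp only [vsub_eq_sub, vadd_eq_add]
    module
  exact hUC (a := ⟨_, hS⟩) hm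

lemma aux_ri_of {n : ℕ} {C U : Set (Vec n)} {x : Vec n} (hx : x ∈ C) (hU : IsOpen U) (hxU : x ∈ U)
    (h : ∀ y ∈ U, y ∈ affineSpan ℝ C → y ∈ C) : x ∈ ri C := by
  unfold ri
  rw [mem_intrinsicInterior]
  refine ⟨⟨x, subset_affineSpan ℝ C hx⟩, ?_, rfl⟩
  rw [mem_interior]
  refine ⟨Subtype.val ⁻¹' U, ?_, hU.preimage continuous_subtype_val, hxU⟩
  intro y hy
  exact h y hy y.2

lemma aux_face {n : ℕ} {X G : Set (Vec n)} (hG : IsFace X G) {x y : Vec n} (hx : x ∈ G)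
    (hy : y ∈ X) {ε : ℝ} (hε : 0 < ε) (hz : x + ε • (x - y) ∈ X) : y ∈ G := by
  refine hG.2.2 hy hz hx ?_
  refine ⟨ε / (1 + ε), 1 / (1 + ε), by positivity, by positivity, by field_simp; ring, ?_⟩
  ext i
  simp
  field_simp
  ring

lemma aux_sign_abs (a : ℝ) : Real.sign a * a = |a| := by
  rcases lt_trichotomy a 0 with h | h | h
  · rw [Real.sign_of_neg h, abs_of_neg h]; ring
  · simp [h]
  · rw [Real.sign_of_pos h, abs_of_pos h]; ring

lemma aux_sign_mul_le (s a : ℝ) : Real.sign s * a ≤ |a| := by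
  rcases Real.sign_apply_eq s with h | h | h <;> rw [h]
  · simpa using neg_le_abs a
  · simp
  · simpa using le_abs_self a

lemma aux_sleq1 (a b : ℝ) : (Real.sign a ≠ 0 → Real.sign b = Real.sign a) ↔
    |a| = Real.sign b * a := by
  constructor
  · intro h
    by_cases h0 : a = 0
    · simp [h0]
    · rw [h (by rwa [Ne, Real.sign_eq_zero_iff]), aux_sign_abs]
  · intro h h0
    rw [Ne, Real.sign_eq_zero_iff] at h0
    rw [← aux_sign_abs] at h
    exact (mul_right_cancel₀ h0 h).symm

lemma aux_sgn1 (a b : ℝ) : Real.sign a = Real.sign b ↔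
    (|a| = Real.sign b * a ∧ (Real.sign b ≠ 0 → 0 < Real.sign b * a)) := by
  constructor
  · intro h
    rw [← h]
    refine ⟨(aux_sign_abs a).symm, fun h0 => ?_⟩
    rw [Ne, Real.sign_eq_zero_iff] at h0
    rw [aux_sign_abs]; positivity
  · rintro ⟨h1, h2⟩
    by_cases h0 : a = 0
    · subst h0
      by_contra hne
      have : Real.sign b ≠ 0 := by
        intro h; apply hne; rw [h]; simp
      simpa using h2 this
    · exact ((aux_sleq1 a b).2 h1 (by rwa [Ne, Real.sign_eq_zero_iff])).symm

/-- for an affine subspace `A` meeting `∂B₁`, `x̄ ∈ A ∩ ∂B₁`, `s̄ = sign(D*x̄)`,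
`J̄ = cosupp(D*x̄)`, `F̄ = B₁ ∩ {x : ⟨Ds̄,x⟩ = 1}` and `Ḡ = A ∩ F̄`: (i) `Ḡ` is the smallest face of
`A ∩ B₁` containing `x̄` and the unique face with `x̄` in its relative interior; (ii) explicit
descriptions of `Ḡ`, `ri(Ḡ)`, `dir(Ḡ)`; (iii) strengthened descriptions when `A ∩ B₁ ⊆ ∂B₁`. -/
theorem stmt_8 {n p : ℕ} (hn : 0 < n) (hp : 0 < p) (D : Matrix (Fin n) (Fin p) ℝ)
    (A : AffineSubspace ℝ (Vec n))
    (hA : ((A : Set (Vec n)) ∩ Sph D 1).Nonempty)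
    (xb : Vec n) (hxbA : xb ∈ A) (hxbS : xb ∈ Sph D 1)
    (sb : Vec p) (hsb : sb = sgn (Dstar D xb))
    (Jb : Set (Fin p)) (hJb : Jb = cosupp (Dstar D xb))
    (Fb : Set (Vec n)) (hFb : Fb = Ball D 1 ∩ {x | (D *ᵥ sb) ⬝ᵥ x = 1})
    (Gb : Set (Vec n)) (hGb : Gb = (A : Set (Vec n)) ∩ Fb) :
    -- (i)
    (IsFace ((A : Set (Vec n)) ∩ Ball D 1) Gb ∧ xb ∈ Gb ∧
      (∀ G : Set (Vec n), IsFace ((A : Set (Vec n)) ∩ Ball D 1) G → xb ∈ G → Gb ⊆ G) ∧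
      xb ∈ ri Gb ∧
      (∀ G : Set (Vec n), IsFace ((A : Set (Vec n)) ∩ Ball D 1) G → xb ∈ ri G → G = Gb)) ∧
    -- (ii)
    (Gb = (A : Set (Vec n)) ∩ Sph D 1 ∩ {x | sleq (sgn (Dstar D x)) sb} ∧
      ri Gb = (A : Set (Vec n)) ∩ Sph D 1 ∩ {x | sgn (Dstar D x) = sb} ∧
      dir Gb = (A.direction : Set (Vec n)) ∩ {d : Vec n | (D *ᵥ sb) ⬝ᵥ d = 0} ∩ kerDJ D Jb) ∧
    -- (iii)
    ((A : Set (Vec n)) ∩ Ball D 1 ⊆ Sph D 1 →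
      Gb = (A : Set (Vec n)) ∩ {x | sleq (sgn (Dstar D x)) sb} ∧
      ri Gb = (A : Set (Vec n)) ∩ {x | sgn (Dstar D x) = sb} ∧
      dir Gb = (A.direction : Set (Vec n)) ∩ kerDJ D Jb) := by
  have hX : ∀ {x d : Vec n}, x ∈ A → d ∈ A.direction → ∀ t : ℝ, x + t • d ∈ A := by
    intro x d hx hd t
    have := AffineSubspace.vadd_mem_of_mem_direction (A.direction.smul_mem t hd) hx
    rwa [vadd_eq_add, add_comm] at this
  have hsub : ∀ {x y : Vec n}, x ∈ A → y ∈ A → x - y ∈ A.direction := by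
    intro x y hx hy
    exact AffineSubspace.vsub_mem_direction hx hy
  have hsi : ∀ i, sb i = Real.sign (Dstar D xb i) := by intro i; rw [hsb]; rfl
  have hle : ∀ (x : Vec n) i, sb i * Dstar D x i ≤ |Dstar D x i| := by
    intro x i; rw [hsi]; exact aux_sign_mul_le _ _
  have hsleq : ∀ x, sleq (sgn (Dstar D x)) sb ↔ ∀ i, |Dstar D x i| = sb i * Dstar D x i := by
    intro x
    refine forall_congr' fun i => ?_
    rw [hsi]; exact aux_sleq1 _ _
  have hsgn : ∀ x, sgn (Dstar D x) = sb ↔ ((∀ i, |Dstar D x i| = sb i * Dstar D x i) ∧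
      ∀ i, sb i ≠ 0 → 0 < sb i * Dstar D x i) := by
    intro x
    rw [funext_iff, ← forall_and]
    refine forall_congr' fun i => ?_
    rw [hsi]; exact aux_sgn1 _ _
  have hsgnb := (hsgn xb).1 hsb.symm
  have hJ : ∀ i, i ∈ Jb ↔ sb i = 0 := by
    intro i; rw [hJb, hsi, Real.sign_eq_zero_iff]; rfl
  have hl1 : ∀ x, (∀ i, |Dstar D x i| = sb i * Dstar D x i) →
      l1 (Dstar D x) = (D *ᵥ sb) ⬝ᵥ x := by
    intro x h
    rw [aux_dot]; exact Finset.sum_congr rfl fun i _ => h i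
  -- membership in Gb
  have hG : ∀ x, x ∈ Gb ↔ x ∈ A ∧ (D *ᵥ sb) ⬝ᵥ x = 1 ∧
      ∀ i, |Dstar D x i| = sb i * Dstar D x i := by
    intro x
    rw [hGb, hFb]
    constructor
    · rintro ⟨h1, h2, h3⟩
      refine ⟨h1, h3, ?_⟩
      have h4 : ∑ i, sb i * Dstar D x i = ∑ i, |Dstar D x i| := by
        apply le_antisymm (Finset.sum_le_sum fun i _ => hle x i)
        have h3' : (D *ᵥ sb) ⬝ᵥ x = 1 := h3
        rw [← aux_dot, h3']; exact h2
      intro i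
      exact ((Finset.sum_eq_sum_iff_of_le fun i _ => hle x i).1 h4 i (Finset.mem_univ i)).symm
    · rintro ⟨h1, h2, h3⟩
      refine ⟨h1, ?_, h2⟩
      exact ((hl1 x h3).trans h2).le
  have hdotb : (D *ᵥ sb) ⬝ᵥ xb = 1 := by rw [← hl1 xb hsgnb.1]; exact hxbS
  have hxG : xb ∈ Gb := (hG xb).2 ⟨hxbA, hdotb, hsgnb.1⟩
  have hGX : Gb ⊆ (A : Set (Vec n)) ∩ Ball D 1 := by
    rw [hGb, hFb]; exact fun x hx => ⟨hx.1, hx.2.1⟩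
  have hbound : ∀ x ∈ Ball D 1, (D *ᵥ sb) ⬝ᵥ x ≤ 1 := by
    intro x hx
    rw [aux_dot]; exact (Finset.sum_le_sum fun i _ => hle x i).trans hx
  -- the open neighbourhood
  let U : Set (Vec n) := {x | ∀ i, sb i ≠ 0 → 0 < sb i * Dstar D x i}
  have hUo : IsOpen U := by
    have : U = ⋂ i, {x | sb i ≠ 0 → 0 < sb i * Dstar D x i} := by ext x; simp [U]
    rw [this]
    refine isOpen_iInter_of_finite fun i => ?_
    by_cases h : sb i = 0
    · simp [h]
    · simp only [ne_eq, h, not_false_eq_true, forall_const]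
      exact isOpen_lt continuous_const (continuous_const.mul (aux_Dcont D i))
  have hUabs : ∀ x ∈ U, (∀ i ∈ Jb, Dstar D x i = 0) →
      ∀ i, |Dstar D x i| = sb i * Dstar D x i := by
    intro x hx hk i
    by_cases h : sb i = 0
    · simp [hk i ((hJ i).2 h)]
    · have h1 := hx i h
      have h2 : |sb i| = 1 := by
        rcases Real.sign_apply_eq (Dstar D xb i) with h' | h' | h' <;> rw [← hsi] at h'
        · simp [h']
        · exact absurd h' h
        · simp [h']
      rw [← abs_of_pos h1, abs_mul, h2, one_mul]
  have hGk : ∀ x ∈ Gb, ∀ i ∈ Jb, Dstar D x i = 0 := by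
    intro x hx i hi
    have := ((hG x).1 hx).2.2 i
    rw [(hJ i).1 hi] at this
    simpa using this
  let W : Submodule ℝ (Vec n) :=
    { carrier := (A.direction : Set (Vec n)) ∩ {d : Vec n | (D *ᵥ sb) ⬝ᵥ d = 0} ∩ kerDJ D Jb
      zero_mem' := ⟨⟨A.direction.zero_mem, by simp⟩, by intro i _; simp [Dstar]⟩
      add_mem' := by
        rintro a b ⟨⟨h1, h2⟩, h3⟩ ⟨⟨h4, h5⟩, h6⟩
        refine ⟨⟨A.direction.add_mem h1 h4, ?_⟩, ?_⟩
        · simp only [Set.mem_setOf_eq] at h2 h5 ⊢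
          rw [dotProduct_add, h2, h5, add_zero]
        · intro i hi
          have e := aux_Dadd D a b 1 i
          rw [one_smul] at e
          rw [e, h3 i hi, h6 i hi]; simp
      smul_mem' := by
        rintro c a ⟨⟨h1, h2⟩, h3⟩
        refine ⟨⟨A.direction.smul_mem c h1, ?_⟩, ?_⟩
        · simp only [Set.mem_setOf_eq] at h2 ⊢
          rw [dotProduct_smul, h2, smul_zero]
        · intro i hi
          have e := aux_Dadd D 0 a c i
          rw [zero_add] at e
          rw [e, h3 i hi]; simp [Dstar] }
  have hspan : affineSpan ℝ Gb ≤ AffineSubspace.mk' xb W := by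
    rw [affineSpan_le]
    intro x hx
    have hx' := (hG x).1 hx
    refine (AffineSubspace.mem_mk').2 ?_
    refine ⟨⟨hsub hx'.1 hxbA, ?_⟩, ?_⟩
    · change (D *ᵥ sb) ⬝ᵥ (x - xb) = 0
      rw [dotProduct_sub, hx'.2.1, hdotb, sub_self]
    · intro i hi
      rw [vsub_eq_sub, aux_Dsub, hGk x hx i hi, hGk xb hxG i hi, sub_self]
  have hUG : ∀ y ∈ U, y - xb ∈ W → y ∈ Gb := by
    rintro y hy ⟨⟨h1, h2⟩, h3⟩
    refine (hG y).2 ⟨?_, ?_, hUabs y hy ?_⟩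
    · simpa using hX hxbA h1 1
    · simp only [Set.mem_setOf_eq, dotProduct_sub] at h2
      linarith
    · intro i hi
      have := h3 i hi
      rw [aux_Dsub, hGk xb hxG i hi] at this
      linarith
  have hri1 : ∀ x ∈ Gb, x ∈ U → x ∈ ri Gb := by
    intro x hx hxU
    refine aux_ri_of hx hUo hxU fun y hy hyS => hUG y hy ?_
    exact (AffineSubspace.mem_mk').1 (hspan hyS)
  have hri2 : ∀ x ∈ ri Gb, x ∈ U := by
    intro x hx i hi
    obtain ⟨ε, hε, hz⟩ := aux_ri_extend hx hxG
    have h1 := ((hG _).1 hz).2.2 i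
    rw [aux_Dadd, aux_Dsub] at h1
    have h2 := hsgnb.2 i hi
    have h3 := abs_nonneg (Dstar D x i + ε * (Dstar D x i - Dstar D xb i))
    rw [h1] at h3
    have h4 : 0 < ε * (sb i * Dstar D xb i) := mul_pos hε h2
    have h5 : 0 < (1 + ε) * (sb i * Dstar D x i) := by nlinarith
    exact pos_of_mul_pos_right h5 (by positivity)
  have hxri : xb ∈ ri Gb := hri1 xb hxG hsgnb.2
  -- small perturbations
  have hpert : ∀ d : Vec n, ∃ ε : ℝ, 0 < ε ∧ ∀ t : ℝ, |t| ≤ ε → xb + t • d ∈ U := by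
    intro d
    have hc : Continuous (fun t : ℝ => xb + t • d) := by fun_prop
    have h0 : ∀ᶠ t : ℝ in nhds 0, xb + t • d ∈ U := by
      apply hc.continuousAt.eventually_mem
      simpa using hUo.mem_nhds (show xb ∈ U from hsgnb.2)
    rw [Metric.eventually_nhds_iff] at h0
    obtain ⟨ε, hε, h⟩ := h0
    refine ⟨ε / 2, by positivity, fun t ht => h ?_⟩
    rw [Real.dist_eq, sub_zero]; linarith
  have hdir : dir Gb = (A.direction : Set (Vec n)) ∩ {d : Vec n | (D *ᵥ sb) ⬝ᵥ d = 0} ∩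
      kerDJ D Jb := by
    change ((affineSpan ℝ Gb).direction : Set (Vec n)) = (W : Set (Vec n))
    apply Set.Subset.antisymm
    · have := AffineSubspace.direction_le hspan
      rwa [AffineSubspace.direction_mk'] at this
    · intro d hd
      obtain ⟨ε, hε, h⟩ := hpert d
      have h1 : xb + ε • d ∈ Gb := by
        refine hUG _ (h ε (abs_of_pos hε).le) ?_
        rw [add_sub_cancel_left]; exact W.smul_mem ε hd
      have h2 := AffineSubspace.vsub_mem_direction (subset_affineSpan ℝ Gb h1)
        (subset_affineSpan ℝ Gb hxG)
      rw [vsub_eq_sub, add_sub_cancel_left] at h2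
      have h3 := (affineSpan ℝ Gb).direction.smul_mem ε⁻¹ h2
      rwa [smul_smul, inv_mul_cancel₀ hε.ne', one_smul] at h3
  have hface : IsFace ((A : Set (Vec n)) ∩ Ball D 1) Gb := by
    refine ⟨?_, hGX, ?_⟩
    · intro x hx y hy a b ha hb hab
      have hx' := (hG x).1 hx
      have hy' := (hG y).1 hy
      have e : a • x + b • y = x + b • (y - x) := by
        have : a = 1 - b := by linarith
        subst this; module
      have hD : (D *ᵥ sb) ⬝ᵥ (a • x + b • y) = 1 := by
        rw [dotProduct_add, dotProduct_smul, dotProduct_smul, hx'.2.1, hy'.2.1]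
        simpa using hab
      refine (hG _).2 ⟨?_, hD, ?_⟩
      · rw [e]; exact hX hx'.1 (hsub hy'.1 hx'.1) b
      · intro i
        have e2 : Dstar D (a • x + b • y) i = a * Dstar D x i + b * Dstar D y i := by
          simp [Dstar, Matrix.mulVec_add, Matrix.mulVec_smul]
        apply le_antisymm _ (hle _ i)
        rw [e2]
        refine (abs_add_le _ _).trans ?_
        rw [abs_mul, abs_mul, abs_of_nonneg ha, abs_of_nonneg hb, hx'.2.2 i, hy'.2.2 i]
        apply le_of_eq; ring
    · intro x hx y hy z hz hzs
      have hz' := (hG z).1 hz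
      obtain ⟨a, b, ha, hb, hab, rfl⟩ := hzs
      have h1 := hbound x hx.2
      have h2 := hbound y hy.2
      have h3 := hz'.2.1
      rw [dotProduct_add, dotProduct_smul, dotProduct_smul, smul_eq_mul, smul_eq_mul] at h3
      have h4 : (D *ᵥ sb) ⬝ᵥ x = 1 := by
        apply le_antisymm h1
        by_contra hlt
        push Not at hlt
        nlinarith [mul_lt_mul_of_pos_left hlt ha, mul_le_mul_of_nonneg_left h2 hb.le]
      rw [hGb, hFb]
      exact ⟨hx.1, hx.2, h4⟩
  have hii1 : Gb = (A : Set (Vec n)) ∩ Sph D 1 ∩ {x | sleq (sgn (Dstar D x)) sb} := by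
    ext x
    constructor
    · intro hx
      have hx' := (hG x).1 hx
      exact ⟨⟨hx'.1, (hl1 x hx'.2.2).trans hx'.2.1⟩, (hsleq x).2 hx'.2.2⟩
    · rintro ⟨⟨h1, h2⟩, h3⟩
      have h4 := (hsleq x).1 h3
      exact (hG x).2 ⟨h1, (hl1 x h4).symm.trans h2, h4⟩
  have hii2 : ri Gb = (A : Set (Vec n)) ∩ Sph D 1 ∩ {x | sgn (Dstar D x) = sb} := by
    ext x
    constructor
    · intro hx
      have hxU := hri2 x hx
      have hx' := (hG x).1 (intrinsicInterior_subset hx)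
      exact ⟨⟨hx'.1, (hl1 x hx'.2.2).trans hx'.2.1⟩, (hsgn x).2 ⟨hx'.2.2, hxU⟩⟩
    · rintro ⟨⟨h1, h2⟩, h3⟩
      have h4 := (hsgn x).1 h3
      exact hri1 x ((hG x).2 ⟨h1, (hl1 x h4.1).symm.trans h2, h4.1⟩) h4.2
  have hmin : ∀ G : Set (Vec n), IsFace ((A : Set (Vec n)) ∩ Ball D 1) G → xb ∈ G → Gb ⊆ G := by
    intro G hGf hxb y hy
    obtain ⟨ε, hε, hz⟩ := aux_ri_extend hxri hy
    exact aux_face hGf hxb (hGX hy) hε (hGX hz)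
  refine ⟨⟨hface, hxG, hmin, hxri, ?_⟩, ⟨hii1, hii2, hdir⟩, ?_⟩
  · intro G hGf hxr
    apply Set.Subset.antisymm _ (hmin G hGf (intrinsicInterior_subset hxr))
    intro y hy
    obtain ⟨ε, hε, hz⟩ := aux_ri_extend hxr hy
    exact aux_face hface hxG (hGf.2.1 hy) hε (hGf.2.1 hz)
  · intro hsubS
    have key : ∀ d ∈ A.direction, d ∈ kerDJ D Jb → (D *ᵥ sb) ⬝ᵥ d = 0 := by
      intro d hd hk
      obtain ⟨ε, hε, h⟩ := hpert d
      have hval : ∀ t : ℝ, |t| ≤ ε → 0 ≤ t * ((D *ᵥ sb) ⬝ᵥ d) := by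
        intro t ht
        have h1 := hl1 _ (hUabs _ (h t ht) (by
          intro i hi
          rw [aux_Dadd, hGk xb hxG i hi, hk i hi]; simp))
        rw [dotProduct_add, dotProduct_smul, hdotb, smul_eq_mul] at h1
        by_contra hlt
        push Not at hlt
        have h2 : l1 (Dstar D (xb + t • d)) = 1 :=
          hsubS ⟨hX hxbA hd t, show l1 (Dstar D (xb + t • d)) ≤ 1 by linarith⟩
        linarith
      have h1 := hval ε (abs_of_pos hε).le
      have h2 := hval (-ε) (by rw [abs_neg]; exact (abs_of_pos hε).le)
      have h3 : ε * ((D *ᵥ sb) ⬝ᵥ d) = 0 := by linarith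
      exact (mul_eq_zero.1 h3).resolve_left hε.ne'
    have key2 : ∀ x ∈ A, (∀ i, |Dstar D x i| = sb i * Dstar D x i) → x ∈ Sph D 1 := by
      intro x hx h
      have h1 := key (x - xb) (hsub hx hxbA) (by
        intro i hi
        have := h i
        rw [(hJ i).1 hi, zero_mul, abs_eq_zero] at this
        rw [aux_Dsub, this, hGk xb hxG i hi, sub_zero])
      rw [dotProduct_sub, hdotb] at h1
      change l1 (Dstar D x) = 1
      rw [hl1 x h]; linarith
    refine ⟨?_, ?_, ?_⟩
    · rw [hii1]
      ext x
      exact ⟨fun h => ⟨h.1.1, h.2⟩, fun h => ⟨⟨h.1, key2 x h.1 ((hsleq x).1 h.2)⟩, h.2⟩⟩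
    · rw [hii2]
      ext x
      exact ⟨fun h => ⟨h.1.1, h.2⟩, fun h => ⟨⟨h.1, key2 x h.1 ((hsgn x).1 h.2).1⟩, h.2⟩⟩
    · rw [hdir]
      ext d
      exact ⟨fun h => ⟨h.1.1, h.2⟩, fun h => ⟨⟨h.1, key d h.1 h.2⟩, h.2⟩⟩
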